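/- On ℝ² equip the weighted measure μ given by dμ = |x|^{-1} dℒ², and let Ω := {(x₁,x₂) ∈ ℝ² : 0 < x₁ < 1, |x₂| < x₁²}. Let ℋ be the codimension-1 Hausdorff measure on ℝ² with respect to μ, and let ℋ̄ be the codimension-1 Hausdorff measure on the metric space Ω̄ (the closure of Ω with the inherited metric) with respect to the measure μ̄ defined by μ̄(A) := μ(A∩Ω) for A ⊂ Ω̄. Then ℋ({(0,0)}) > 0 while ℋ̄({(0,0)}) = 0. -/

import Mathlib

open Metric MeasureTheory Filter Topology Set Real ENNReal

/-- The codimension-1 Hausdorff content at scale `R` of a set `A`, with respect to a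
set function `m` (e.g. an outer measure) on a metric space. -/
noncomputable def codimContent {X : Type*} [PseudoMetricSpace X]
    (m : Set X → ℝ≥0∞) (R : ℝ) (A : Set X) : ℝ≥0∞ :=
  ⨅ (c : ℕ → X) (ρ : ℕ → ℝ) (_ : ∀ i, 0 < ρ i) (_ : ∀ i, ρ i ≤ R)
    (_ : A ⊆ ⋃ i, Metric.ball (c i) (ρ i)),
    ∑' i, m (Metric.ball (c i) (ρ i)) / ENNReal.ofReal (ρ i)

/-- The codimension-1 Hausdorff measure of `A` with respect to `m`:
`ℋ(A) = lim_{R→0⁺} ℋ_R(A) = sup_{R>0} ℋ_R(A)`. -/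
noncomputable def codimH {X : Type*} [PseudoMetricSpace X]
    (m : Set X → ℝ≥0∞) (A : Set X) : ℝ≥0∞ :=
  ⨆ (R : ℝ) (_ : 0 < R), codimContent m R A

/-- The weighted measure `dμ = |x|⁻¹ dℒ²` on the Euclidean plane. -/
noncomputable def weightedMeasure : Measure (EuclideanSpace ℝ (Fin 2)) :=
  volume.withDensity fun x => ENNReal.ofReal ‖x‖⁻¹

/-- The exterior cusp domain `Ω = {(x₁,x₂) : 0 < x₁ < 1, |x₂| < x₁²}`. -/
def cuspDomain : Set (EuclideanSpace ℝ (Fin 2)) :=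
  {x | 0 < x 0 ∧ x 0 < 1 ∧ |x 1| < (x 0) ^ 2}

/-- A ball of radius `r` containing the origin has weighted measure at least `π r / 2`. -/
lemma pi_div_two_le_weightedMeasure_ball_div {c : EuclideanSpace ℝ (Fin 2)} {r : ℝ} (hr : 0 < r)
    (h0 : (0 : EuclideanSpace ℝ (Fin 2)) ∈ ball c r) :
    ENNReal.ofReal (π / 2) ≤ weightedMeasure (ball c r) / ENNReal.ofReal r := by
  have hr' : ENNReal.ofReal r ≠ 0 := by simpa using hr
  rw [ENNReal.le_div_iff_mul_le (Or.inl hr') (Or.inl ofReal_ne_top), weightedMeasure,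
    withDensity_apply _ measurableSet_ball]
  have hne : ∀ᵐ x : EuclideanSpace ℝ (Fin 2), x ≠ 0 := by
    simp [ae_iff]
  calc ENNReal.ofReal (π / 2) * ENNReal.ofReal r
      = ∫⁻ _ in ball c r, ENNReal.ofReal (2 * r)⁻¹ := by
        rw [lintegral_const, Measure.restrict_apply_univ, EuclideanSpace.volume_ball_fin_two,
          ← ENNReal.ofReal_mul (by positivity), ← ENNReal.ofReal_pow hr.le]
        rw [← ENNReal.ofReal_mul (by positivity), ← ENNReal.ofReal_mul (by positivity)]
        congr 1
        field_simp
    _ ≤ ∫⁻ x in ball c r, ENNReal.ofReal ‖x‖⁻¹ := by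
        refine setLIntegral_mono_ae (by fun_prop) ?_
        filter_upwards [hne] with x hx hxc
        refine ENNReal.ofReal_le_ofReal (inv_anti₀ (norm_pos_iff.2 hx) ?_)
        rw [mem_ball] at hxc h0
        have := dist_triangle_right x 0 c
        rw [dist_zero_right] at this
        linarith

/-- The part of the cusp within distance `r` of its tip has weighted measure at most `2 r²`. -/
lemma weightedMeasure_ball_inter_cuspDomain_le {r : ℝ} (hr : 0 < r) :
    weightedMeasure (ball 0 r ∩ cuspDomain) ≤ ENNReal.ofReal (2 * r ^ 2) := by
  set S : Set (ℝ × ℝ) := {p | 0 < p.1 ∧ p.1 < r ∧ |p.2| < p.1 ^ 2} with hS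
  have hSm : MeasurableSet S := by
    simp only [hS, ofPred_and]
    exact (measurableSet_lt measurable_const measurable_fst).inter
      ((measurableSet_lt measurable_fst measurable_const).inter
        (measurableSet_lt (continuous_abs.measurable.comp measurable_snd)
          (measurable_fst.pow_const 2)))
  set e : EuclideanSpace ℝ (Fin 2) → ℝ × ℝ := fun x => (x 0, x 1)
  have hmp : MeasurePreserving e volume volume :=
    (volume_preserving_finTwoArrow ℝ).comp
      (EuclideanSpace.volume_preserving_symm_measurableEquiv_toLp (Fin 2))
  have hcoord : ∀ x : EuclideanSpace ℝ (Fin 2), |x 0| ≤ ‖x‖ := fun x => by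
    simpa using PiLp.norm_apply_le x 0
  have hsub : ball 0 r ∩ cuspDomain ⊆ e ⁻¹' S := by
    rintro x ⟨hx, h0, -, h2⟩
    rw [mem_ball_zero_iff] at hx
    exact ⟨h0, ((le_abs_self _).trans (hcoord x)).trans_lt hx, h2⟩
  have hfm : Measurable (S.indicator fun p => ENNReal.ofReal p.1⁻¹) :=
    (by fun_prop : Measurable fun p : ℝ × ℝ => ENNReal.ofReal p.1⁻¹).indicator hSm
  calc weightedMeasure (ball 0 r ∩ cuspDomain)
      ≤ weightedMeasure (e ⁻¹' S) := measure_mono hsub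
    _ = ∫⁻ x in e ⁻¹' S, ENNReal.ofReal ‖x‖⁻¹ :=
        withDensity_apply _ (hmp.measurable hSm)
    _ ≤ ∫⁻ x in e ⁻¹' S, ENNReal.ofReal (e x).1⁻¹ := by
        refine setLIntegral_mono' (hmp.measurable hSm) fun x hx => ?_
        exact ENNReal.ofReal_le_ofReal (inv_anti₀ hx.1 ((le_abs_self _).trans (hcoord x)))
    _ = ∫⁻ p in S, ENNReal.ofReal p.1⁻¹ :=
        hmp.setLIntegral_comp_preimage hSm
          (by fun_prop : Measurable fun p : ℝ × ℝ => ENNReal.ofReal p.1⁻¹)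
    _ = ∫⁻ t, ∫⁻ s, S.indicator (fun p => ENNReal.ofReal p.1⁻¹) (t, s) := by
        rw [← lintegral_indicator hSm, Measure.volume_eq_prod, lintegral_prod _ hfm.aemeasurable]
    _ ≤ ∫⁻ t, (Ioo 0 r).indicator (fun _ => ENNReal.ofReal (2 * r)) t := by
        refine lintegral_mono fun t => ?_
        by_cases ht : t ∈ Ioo 0 r
        · rw [indicator_of_mem ht]
          calc ∫⁻ s, S.indicator (fun p => ENNReal.ofReal p.1⁻¹) (t, s)
              ≤ ∫⁻ s, (Ioo (-t ^ 2) (t ^ 2)).indicator (fun _ => ENNReal.ofReal t⁻¹) s := by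
                refine lintegral_mono fun s => ?_
                by_cases hs : (t, s) ∈ S
                · rw [indicator_of_mem hs, indicator_of_mem (show s ∈ Ioo _ _ from abs_lt.1 hs.2.2)]
                · rw [indicator_of_notMem hs]
                  exact zero_le
            _ = ENNReal.ofReal (2 * t) := by
                have := ht.1
                rw [lintegral_indicator measurableSet_Ioo, setLIntegral_const, Real.volume_Ioo,
                  ← ENNReal.ofReal_mul (by positivity)]
                congr 1
                field_simp
                ring
            _ ≤ ENNReal.ofReal (2 * r) := ENNReal.ofReal_le_ofReal (by linarith [ht.2])
        · have : ∀ s, (t, s) ∉ S := fun s hs => ht ⟨hs.1, hs.2.1⟩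
          simp [this]
    _ = ENNReal.ofReal (2 * r ^ 2) := by
        rw [lintegral_indicator measurableSet_Ioo, setLIntegral_const, Real.volume_Ioo,
          ← ENNReal.ofReal_mul (by positivity)]
        congr 1
        ring

/-- The tip of the cusp lies in the closure of the cusp domain. -/
lemma zero_mem_closure_cuspDomain :
    (0 : EuclideanSpace ℝ (Fin 2)) ∈ closure cuspDomain := by
  rw [Metric.mem_closure_iff]
  intro ε hε
  have ht : 0 < min (ε / 2) (1 / 2) := by positivity
  refine ⟨EuclideanSpace.single 0 (min (ε / 2) (1 / 2)), ⟨?_, ?_, ?_⟩, ?_⟩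
  · simpa using hε
  · have := min_le_right (ε / 2) (1 / 2)
    simp only [PiLp.single_apply, if_true]
    linarith
  · simpa using pow_pos ht 2
  · have := min_le_left (ε / 2) (1 / 2)
    rw [dist_zero_left, PiLp.norm_single, Real.norm_of_nonneg ht.le]
    linarith

/-- For the weighted measure `μ` with `dμ = |x|⁻¹dℒ²` on `ℝ²` and the exterior cusp
domain `Ω`, the codimension-1 Hausdorff measure `ℋ` on `ℝ²` (w.r.t. `μ`) gives positive
mass to the origin, while the codimension-1 Hausdorff measure `ℋ̄` on the metric space
`Ω̄` (w.r.t. the zero extension `μ̄(A) = μ(A∩Ω)`) gives the origin zero mass. -/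
theorem cusp_codim_one_measures_differ :
    0 < codimH (fun A => weightedMeasure A) {(0 : EuclideanSpace ℝ (Fin 2))} ∧
    ∃ h : (0 : EuclideanSpace ℝ (Fin 2)) ∈ closure cuspDomain,
      codimH (fun A : Set ↥(closure cuspDomain) =>
          weightedMeasure (Subtype.val '' A ∩ cuspDomain))
        {(⟨0, h⟩ : ↥(closure cuspDomain))} = 0 := by
  refine ⟨?_, zero_mem_closure_cuspDomain, ?_⟩
  · have hpos : 0 < ENNReal.ofReal (π / 2) := ENNReal.ofReal_pos.2 (by positivity)
    refine hpos.trans_le (le_iSup₂_of_le (1 : ℝ) one_pos ?_)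
    refine le_iInf fun c => le_iInf fun ρ => le_iInf fun hρ => le_iInf fun _ => le_iInf fun hc => ?_
    obtain ⟨i, hi⟩ := mem_iUnion.1 (hc rfl)
    exact (pi_div_two_le_weightedMeasure_ball_div (hρ i) hi).trans
      (ENNReal.le_tsum (f := fun i => weightedMeasure (ball (c i) (ρ i)) / ENNReal.ofReal (ρ i)) i)
  · refine iSup₂_eq_bot.2 fun R hR => le_bot_iff.1 ?_
    refine ENNReal.le_of_forall_pos_le_add fun ε hε _ => ?_
    rw [bot_eq_zero, zero_add]
    set δ : ℝ := min R (ε / 4)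
    have hδ : 0 < δ := lt_min hR (by positivity)
    have hρ : ∀ i : ℕ, 0 < δ * (1 / 2) ^ i := fun i => by positivity
    refine iInf_le_of_le (fun _ => ⟨0, zero_mem_closure_cuspDomain⟩) <|
      iInf_le_of_le (fun i => δ * (1 / 2) ^ i) <| iInf_le_of_le hρ <| iInf_le_of_le ?_ <|
      iInf_le_of_le ?_ ?_
    · intro i
      calc δ * (1 / 2) ^ i ≤ δ * 1 := by
            gcongr
            exact pow_le_one₀ (by norm_num) (by norm_num)
        _ ≤ R := by rw [mul_one]; exact min_le_left _ _
    · rintro _ rfl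
      exact mem_iUnion.2 ⟨0, mem_ball_self (hρ 0)⟩
    · calc _ ≤ ∑' i : ℕ, ENNReal.ofReal (2 * (δ * (1 / 2) ^ i)) := by
            refine ENNReal.tsum_le_tsum fun i => ?_
            refine ENNReal.div_le_of_le_mul ?_
            rw [← ENNReal.ofReal_mul (by positivity)]
            have hsub : Subtype.val '' ball
                (⟨0, zero_mem_closure_cuspDomain⟩ : closure cuspDomain) (δ * (1 / 2) ^ i)
                ⊆ ball 0 (δ * (1 / 2) ^ i) := by
              rintro _ ⟨x, hx, rfl⟩
              exact hx
            refine ((measure_mono (inter_subset_inter_left _ hsub)).trans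
              (weightedMeasure_ball_inter_cuspDomain_le (hρ i))).trans_eq ?_
            congr 1
            ring
        _ = ENNReal.ofReal (4 * δ) := by
            have hs : HasSum (fun i : ℕ => 2 * (δ * (1 / 2) ^ i)) (4 * δ) := by
              rw [show 4 * δ = 2 * (δ * 2) by ring]
              exact (hasSum_geometric_two.mul_left δ).mul_left 2
            rw [← ENNReal.ofReal_tsum_of_nonneg (fun i => by positivity) hs.summable, hs.tsum_eq]
        _ ≤ ε := by
            rw [← ENNReal.ofReal_coe_nnreal]
            refine ENNReal.ofReal_le_ofReal ?_
            have := min_le_right R ((ε : ℝ) / 4)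
            linarith
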